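/- Let n ≥ 4 and let L be a suffix-free regular language whose minimal DFA is D = (Q_n, Σ, δ, 0, F) with initial state 0 and empty state n−1, and whose left quotients K_0 = L, …, K_{n−1} (with K_{n−1} = ∅) are the state languages. If L meets the bounds for atom complexities, i.e., for every nonempty S ⊆ {1,…,n−2} the set A_S is an atom with κ(A_S) = 1 + Σ_{x=1}^{|S|} Σ_{y=0}^{n−2−|S|} C(n−2, x)·C(n−2−x, y), then the transition semigroup T of D is contained in Wsf(n) and is not contained in Vsf(n). -/

import Mathlib

/-- The left quotient of a language `L` by a word `w`: `w⁻¹L = {x | wx ∈ L}`. -/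
def leftQuot {α : Type} (w : List α) (L : Set (List α)) : Set (List α) := {x | w ++ x ∈ L}

/-- The quotient complexity of a language: the number of its distinct left quotients. -/
noncomputable def quotComp {α : Type} (L : Set (List α)) : ℕ :=
  {K : Set (List α) | ∃ w : List α, K = leftQuot w L}.ncard

/-- A language is suffix-free if `v ∈ L` and `uv ∈ L` imply `u = ε`. -/
def SuffixFree {α : Type} (L : Set (List α)) : Prop :=
  ∀ u v : List α, v ∈ L → u ++ v ∈ L → u = []

/-- The language accepted by a DFA. -/
def acceptsSet {α Q : Type} (M : DFA α Q) : Set (List α) :=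
  {w | M.evalFrom M.start w ∈ M.accept}

/-- A language is regular if it is accepted by some DFA with finitely many states. -/
def RegularLang {α : Type} (L : Set (List α)) : Prop :=
  ∃ (Q : Type) (_ : Fintype Q) (M : DFA α Q), acceptsSet M = L

/-- The language of a state `q` of a DFA. -/
def stateLang {α Q : Type} (M : DFA α Q) (q : Q) : Set (List α) :=
  {w | M.evalFrom q w ∈ M.accept}

/-- A DFA is minimal if every state is reachable and no two distinct states have
the same language. -/
def MinimalDFA {α Q : Type} (M : DFA α Q) : Prop :=
  (∀ q : Q, ∃ w : List α, M.evalFrom M.start w = q) ∧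
    ∀ p q : Q, stateLang M p = stateLang M q → p = q

/-- The transition semigroup of a DFA: the transformations induced by nonempty words. -/
def transSemigroup {α Q : Type} (M : DFA α Q) : Set (Q → Q) :=
  {t | ∃ w : List α, w ≠ [] ∧ t = fun q => M.evalFrom q w}

/-- Product (concatenation) of two languages. -/
def catLang {α : Type} (K L : Set (List α)) : Set (List α) :=
  {w | ∃ u ∈ K, ∃ v ∈ L, w = u ++ v}

/-- Kleene star of a language. -/
def starLang {α : Type} (L : Set (List α)) : Set (List α) :=
  {w | ∃ ws : List (List α), (∀ u ∈ ws, u ∈ L) ∧ w = ws.flatten}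

/-- Reversal of a language. -/
def revLang {α : Type} (L : Set (List α)) : Set (List α) := {w | w.reverse ∈ L}
/-- `Bsf n`: transformations `t` of `Q_n = {0,…,n-1}` such that `0` is not in the range
of `t`, `(n-1)t = n-1`, and for every `j ≥ 1` either `0t^j = n-1` or `0t^j ≠ qt^j`
for all `q` with `0 < q < n-1`. -/
def Bsf (n : ℕ) (hn : 0 < n) : Set (Fin n → Fin n) :=
  {t | (∀ q : Fin n, t q ≠ ⟨0, hn⟩) ∧ t ⟨n - 1, by omega⟩ = ⟨n - 1, by omega⟩ ∧
    ∀ j : ℕ, 1 ≤ j →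
      (t^[j] ⟨0, hn⟩ = ⟨n - 1, by omega⟩ ∨
        ∀ q : Fin n, 0 < q.val → q.val < n - 1 → t^[j] ⟨0, hn⟩ ≠ t^[j] q)}

/-- `Vsf n`: members of `Bsf n` such that any two distinct states are either both
mapped to `n-1` or mapped to distinct states. -/
def Vsf (n : ℕ) (hn : 0 < n) : Set (Fin n → Fin n) :=
  {t | t ∈ Bsf n hn ∧ ∀ p q : Fin n, p ≠ q →
    (t p = ⟨n - 1, by omega⟩ ∧ t q = ⟨n - 1, by omega⟩) ∨ t p ≠ t q}

/-- `Wsf n`: members of `Bsf n` that either map `0` to `n-1` or map every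
`q` with `1 ≤ q ≤ n-2` to `n-1`. -/
def Wsf (n : ℕ) (hn : 0 < n) : Set (Fin n → Fin n) :=
  {t | t ∈ Bsf n hn ∧ (t ⟨0, hn⟩ = ⟨n - 1, by omega⟩ ∨
    ∀ q : Fin n, 1 ≤ q.val → q.val ≤ n - 2 → t q = ⟨n - 1, by omega⟩)}

/-- The (unordered) pair `{p,q}` of distinct states of `Q_n \ {0, n-1}` is colliding
in the set `T` of transformations. -/
def Colliding {n : ℕ} (hn : 0 < n) (T : Set (Fin n → Fin n)) (p q : Fin n) : Prop :=
  ∃ t ∈ T, ∃ r : Fin n, 0 < r.val ∧ r.val < n - 1 ∧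
    ((t ⟨0, hn⟩ = p ∧ t r = q) ∨ (t ⟨0, hn⟩ = q ∧ t r = p))

/-- The semigroup of transformations generated by `G` under composition:
the least set containing `G` and closed under composition. -/
def genSG {β : Type} (G : Set (β → β)) : Set (β → β) :=
  ⋂₀ {T : Set (β → β) | G ⊆ T ∧ ∀ f ∈ T, ∀ g ∈ T, (g ∘ f) ∈ T}
/-- The atomic intersection `A_S = (⋂_{i∈S} K_i) ∩ (⋂_{i∉S} K_iᶜ)` determined by the
family of quotients `Kq` and the subset `S`; an atom is a nonempty `A_S`. -/
def atomInt {α : Type} {n : ℕ} (Kq : Fin n → Set (List α)) (S : Set (Fin n)) :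
    Set (List α) :=
  {w | ∀ i : Fin n, (i ∈ S → w ∈ Kq i) ∧ (i ∉ S → w ∉ Kq i)}

theorem aux_sf {α : Type} {n : ℕ} (hn : 4 ≤ n) (h0 : 0 < n) (h1 : n - 1 < n) (M : DFA α (Fin n))
    (hstart : M.start = ⟨0, h0⟩) (hmin : MinimalDFA M)
    (hempty : stateLang M ⟨n - 1, h1⟩ = ∅)
    (hsf : SuffixFree (acceptsSet M)) (u a : List α) (hu : u ≠ [])
    (h : M.evalFrom ⟨0, h0⟩ (u ++ a) = M.evalFrom ⟨0, h0⟩ a) :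
    M.evalFrom ⟨0, h0⟩ a = ⟨n - 1, h1⟩ := by
  apply hmin.2
  rw [hempty, Set.eq_empty_iff_forall_notMem]
  intro v hv
  apply hu
  apply hsf u (a ++ v)
  · simp only [acceptsSet, Set.mem_ofPred_eq, hstart, DFA.evalFrom_of_append]
    exact hv
  · rw [← List.append_assoc]
    simp only [acceptsSet, Set.mem_ofPred_eq, hstart]
    rw [DFA.evalFrom_of_append, h]
    exact hv

theorem aux_last {α : Type} {n : ℕ} (hn : 4 ≤ n) (h0 : 0 < n) (h1 : n - 1 < n) (M : DFA α (Fin n))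
    (hmin : MinimalDFA M)
    (hempty : stateLang M ⟨n - 1, h1⟩ = ∅) (w : List α) :
    M.evalFrom ⟨n - 1, h1⟩ w = ⟨n - 1, h1⟩ := by
  apply hmin.2
  rw [hempty, Set.eq_empty_iff_forall_notMem]
  intro v hv
  have : w ++ v ∈ stateLang M ⟨n - 1, h1⟩ := by
    simp only [stateLang, Set.mem_ofPred_eq, DFA.evalFrom_of_append]
    exact hv
  rw [hempty] at this
  exact this

theorem aux_zero {α : Type} {n : ℕ} (hn : 4 ≤ n) (h0 : 0 < n) (h1 : n - 1 < n) (M : DFA α (Fin n))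
    (hstart : M.start = ⟨0, h0⟩) (hmin : MinimalDFA M)
    (hempty : stateLang M ⟨n - 1, h1⟩ = ∅)
    (hsf : SuffixFree (acceptsSet M)) (w : List α) (hw : w ≠ []) (q : Fin n) :
    M.evalFrom q w ≠ ⟨0, h0⟩ := by
  intro h
  obtain ⟨u, rfl⟩ := hmin.1 q
  rw [hstart] at h
  have := aux_sf hn h0 h1 M hstart hmin hempty hsf (u ++ w) [] (by simp [hw])
    (by rw [List.append_nil, DFA.evalFrom_of_append, h]; rfl)
  simp only [DFA.evalFrom_nil, Fin.mk.injEq] at this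
  omega

theorem aux_iter {α : Type} {n : ℕ} (M : DFA α (Fin n)) (w : List α) (j : ℕ) (q : Fin n) :
    (fun q => M.evalFrom q w)^[j] q = M.evalFrom q (List.replicate j w).flatten := by
  induction j generalizing q with
  | zero => rfl
  | succ k ih =>
    rw [Function.iterate_succ_apply, ih, List.replicate_succ, List.flatten_cons,
      DFA.evalFrom_of_append]

theorem aux_sf' {α : Type} {n : ℕ} (hn : 4 ≤ n) (h0 : 0 < n) (h1 : n - 1 < n) (M : DFA α (Fin n))
    (hstart : M.start = ⟨0, h0⟩) (hmin : MinimalDFA M)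
    (hempty : stateLang M ⟨n - 1, h1⟩ = ∅)
    (hsf : SuffixFree (acceptsSet M)) (q : Fin n) (hq : 0 < q.val) (a : List α)
    (h : M.evalFrom ⟨0, h0⟩ a = M.evalFrom q a) :
    M.evalFrom ⟨0, h0⟩ a = ⟨n - 1, h1⟩ := by
  obtain ⟨u, rfl⟩ := hmin.1 q
  rw [hstart] at h hq
  apply aux_sf hn h0 h1 M hstart hmin hempty hsf u a
  · rintro rfl
    simp at hq
  · rw [DFA.evalFrom_of_append, h]

theorem aux_bsf {α : Type} {n : ℕ} (hn : 4 ≤ n) (h0 : 0 < n) (h1 : n - 1 < n) (M : DFA α (Fin n))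
    (hstart : M.start = ⟨0, h0⟩) (hmin : MinimalDFA M)
    (hempty : stateLang M ⟨n - 1, h1⟩ = ∅)
    (hsf : SuffixFree (acceptsSet M)) : transSemigroup M ⊆ Bsf n h0 := by
  rintro t ⟨w, hw, rfl⟩
  refine ⟨aux_zero hn h0 h1 M hstart hmin hempty hsf w hw, aux_last hn h0 h1 M hmin hempty w, ?_⟩
  intro j hj
  by_contra! hc
  obtain ⟨g1, q, hq, -, h2⟩ := hc
  rw [aux_iter] at g1 h2
  rw [aux_iter] at h2
  exact g1 (aux_sf' hn h0 h1 M hstart hmin hempty hsf q hq _ h2)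

theorem aux_drop {α : Type} {n : ℕ} (hn : 4 ≤ n) (h0 : 0 < n) (h1 : n - 1 < n) (M : DFA α (Fin n))
    (hstart : M.start = ⟨0, h0⟩) (hmin : MinimalDFA M)
    (hempty : stateLang M ⟨n - 1, h1⟩ = ∅)
    (hsf : SuffixFree (acceptsSet M)) (w : List α) (hw : w ≠ []) :
    ∃ i : Fin n, i ≠ ⟨n - 1, h1⟩ ∧ M.evalFrom i w = ⟨n - 1, h1⟩ := by
  by_contra! hc
  have hne : ∀ j : ℕ, (fun q => M.evalFrom q w)^[j] ⟨0, h0⟩ ≠ ⟨n - 1, h1⟩ := by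
    intro j
    induction j with
    | zero => simp only [Function.iterate_zero, id, ne_eq, Fin.mk.injEq]; omega
    | succ k ih =>
      rw [Function.iterate_succ_apply']
      exact hc _ ih
  obtain ⟨a, b, hab, h⟩ := Finite.exists_ne_map_eq_of_infinite
    (fun j : ℕ => (fun q => M.evalFrom q w)^[j] (⟨0, h0⟩ : Fin n))
  wlog hlt : a < b generalizing a b
  · exact this b a hab.symm h.symm (by omega)
  obtain ⟨k, rfl⟩ := Nat.exists_eq_add_of_lt hlt
  apply hne a
  rw [show a + k + 1 = a + (k + 1) by omega, Function.iterate_add_apply] at h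
  rw [aux_iter, aux_iter] at h
  rw [aux_iter]
  refine aux_sf' hn h0 h1 M hstart hmin hempty hsf _ ?_ _ h
  rw [Function.iterate_succ_apply', Nat.pos_iff_ne_zero]
  intro hh
  exact aux_zero hn ‹_› h1 M hstart hmin hempty hsf w hw _ (Fin.ext hh)

def auxLg {α : Type} {n : ℕ} (M : DFA α (Fin n)) (X Y : Finset (Fin n)) : Set (List α) :=
  {v | (∀ x ∈ X, v ∈ stateLang M x) ∧ ∀ y ∈ Y, v ∉ stateLang M y}

theorem aux_merge {α : Type} (n : ℕ) (hn : 4 ≤ n) (h0 : 0 < n) (h1 : n - 1 < n) (M : DFA α (Fin n))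
    (hstart : M.start = ⟨0, h0⟩) (hmin : MinimalDFA M)
    (hempty : stateLang M ⟨n - 1, h1⟩ = ∅)
    (hsf : SuffixFree (acceptsSet M))
    (hatoms : ∀ S : Set (Fin n), S ≠ ∅ → (∀ i ∈ S, 0 < i.val ∧ i.val < n - 1) →
      atomInt (stateLang M) S ≠ ∅ ∧
      quotComp (atomInt (stateLang M) S) =
        1 + ∑ x ∈ Finset.Icc 1 S.ncard, ∑ y ∈ Finset.Icc 0 (n - 2 - S.ncard),
          Nat.choose (n - 2) x * Nat.choose (n - 2 - x) y)
    (p r : Fin n) (hpr : p ≠ r) (hp : 0 < p.val ∧ p.val < n - 1)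
    (hr : 0 < r.val ∧ r.val < n - 1) :
    ∃ w : List α, w ≠ [] ∧ M.evalFrom p w = M.evalFrom r w ∧
      M.evalFrom p w ≠ ⟨n - 1, h1⟩ := by
  classical
  by_contra! hc
  have hq := (hatoms {p, r} (Set.insert_nonempty _ _).ne_empty (by
    rintro i (rfl | rfl) <;> assumption)).2
  rw [Set.ncard_pair hpr] at hq
  set z : Fin n := ⟨0, h0⟩ with hz
  set l : Fin n := ⟨n - 1, h1⟩ with hl
  have hzl : z ≠ l := by simp only [hz, hl, ne_eq, Fin.mk.injEq]; omega
  have hpz : p ≠ z := by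
    intro h; rw [h] at hp; simp [hz] at hp
  have hrz : r ≠ z := by
    intro h; rw [h] at hr; simp [hz] at hr
  have hpl : p ≠ l := by
    intro h; rw [h] at hp; simp [hl] at hp
  have hrl : r ≠ l := by
    intro h; rw [h] at hr; simp [hl] at hr
  set mid : Finset (Fin n) := (Finset.univ.erase z).erase l with hmid
  have hmc : mid.card = n - 2 := by
    rw [hmid, Finset.card_erase_of_mem (by simp [hzl.symm]),
      Finset.card_erase_of_mem (by simp), Finset.card_univ, Fintype.card_fin]
    omega
  have hE : ∀ v, v ∉ stateLang M l := by
    intro v; rw [hempty]; exact id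
  set T : Finset (Set (List α)) := insert ∅ ((Finset.Icc 0 (n - 2 - 2)).biUnion fun y =>
    (Finset.powersetCard 2 mid).biUnion fun X =>
      (Finset.powersetCard y (mid \ X)).image (auxLg M X)) with hT
  have hTc : T.card ≤ 1 + ∑ y ∈ Finset.Icc 0 (n - 2 - 2),
      Nat.choose (n - 2) 2 * Nat.choose (n - 2 - 2) y := by
    rw [add_comm]
    refine (Finset.card_insert_le _ _).trans (Nat.add_le_add_right ?_ 1)
    refine Finset.card_biUnion_le.trans (Finset.sum_le_sum fun y _ => ?_)
    refine Finset.card_biUnion_le.trans ?_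
    rw [← hmc, ← Finset.card_powersetCard, ← smul_eq_mul, ← Finset.sum_const]
    refine Finset.sum_le_sum fun X hX => Finset.card_image_le.trans ?_
    rw [Finset.mem_powersetCard] at hX
    rw [Finset.card_powersetCard, Finset.card_sdiff_of_subset hX.1, hX.2]
  have hmemT : ∀ X Y : Finset (Fin n), X ⊆ mid → X.card = 2 → Y ⊆ mid → Disjoint X Y →
      Y.card ≤ n - 2 - 2 → auxLg M X Y ∈ T := by
    intro X Y h1 h2 h3 h4 h5
    refine Finset.mem_insert_of_mem ?_
    simp only [Finset.mem_biUnion, Finset.mem_image, Finset.mem_powersetCard, Finset.mem_Icc]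
    exact ⟨Y.card, ⟨by omega, h5⟩, X, ⟨h1, h2⟩, Y,
      ⟨Finset.subset_sdiff.2 ⟨h3, h4.symm⟩, rfl⟩, rfl⟩
  have hsub : {K : Set (List α) | ∃ w : List α, K = leftQuot w (atomInt (stateLang M) {p, r})}
      ⊆ (T : Set (Set (List α))) := by
    rintro K ⟨w, rfl⟩
    rw [Finset.mem_coe]
    by_cases hw : w = []
    · subst hw
      have : leftQuot [] (atomInt (stateLang M) {p, r}) = auxLg M {p, r} (mid \ {p, r}) := by
        ext v
        simp only [leftQuot, List.nil_append, atomInt, Set.mem_ofPred_eq, auxLg]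
        constructor
        · intro h
          refine ⟨fun x hx => (h x).1 (by simpa using hx), fun y hy => (h y).2 ?_⟩
          rw [Finset.mem_sdiff] at hy
          simpa using hy.2
        · rintro ⟨h1, h2⟩ i
          refine ⟨fun hi => h1 i (by simpa using hi), fun hi => ?_⟩
          by_cases hil : i = l
          · rw [hil]; exact hE v
          by_cases hiz : i = z
          · intro hv
            have hv2 := h1 p (by simp)
            obtain ⟨u, hu⟩ := hmin.1 p
            have : u = [] := by
              apply hsf u v
              · simp only [acceptsSet, Set.mem_ofPred_eq, hstart]
                rw [hiz] at hv
                exact hv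
              · simp only [acceptsSet, Set.mem_ofPred_eq, DFA.evalFrom_of_append, hu]
                exact hv2
            subst this
            rw [DFA.evalFrom_nil, hstart] at hu
            exact hpz hu.symm
          · apply h2
            simp only [Finset.mem_sdiff, hmid, Finset.mem_erase, Finset.mem_univ]
            exact ⟨⟨hil, hiz, trivial⟩, by simpa using hi⟩
      rw [this]
      have hs : ({p, r} : Finset (Fin n)) ⊆ mid := by
        intro i hi
        simp only [Finset.mem_insert, Finset.mem_singleton] at hi
        rcases hi with rfl | rfl <;> simp [hmid, hpz, hrz, hpl, hrl]
      apply hmemT _ _ hs (Finset.card_pair hpr) Finset.sdiff_subset Finset.disjoint_sdiff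
      rw [Finset.card_sdiff_of_subset hs, hmc, Finset.card_pair hpr]
    · by_cases hne : leftQuot w (atomInt (stateLang M) {p, r}) = ∅
      · rw [hne]; simp [hT]
      obtain ⟨v, hv⟩ := Set.nonempty_iff_ne_empty.2 hne
      set f : Fin n → Fin n := fun q => M.evalFrom q w with hf
      have key : ∀ x : List α, x ∈ leftQuot w (atomInt (stateLang M) {p, r}) ↔
          ∀ i : Fin n, ((i = p ∨ i = r) → x ∈ stateLang M (f i)) ∧
            (¬ (i = p ∨ i = r) → x ∉ stateLang M (f i)) := by
        intro x
        simp only [leftQuot, atomInt, Set.mem_ofPred_eq, stateLang, DFA.evalFrom_of_append, hf,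
          Set.mem_insert_iff, Set.mem_singleton_iff]
      have hv' := (key v).1 hv
      have hfl : f l = l := aux_last hn h0 h1 M hmin hempty w
      have hfz : ∀ i, f i ≠ z := aux_zero hn h0 h1 M hstart hmin hempty hsf w hw
      have hfp : f p ≠ l := fun h => hE v (h ▸ (hv' p).1 (Or.inl rfl))
      have hfr : f r ≠ l := fun h => hE v (h ▸ (hv' r).1 (Or.inr rfl))
      have hfpr : f p ≠ f r := fun h => hfp (hc w hw h)
      set Y : Finset (Fin n) := ((Finset.univ \ {p, r}).image f).erase l with hY
      have hmY : ∀ y, y ∈ Y ↔ y ≠ l ∧ ∃ j, ¬ (j = p ∨ j = r) ∧ f j = y := by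
        intro y
        simp [hY]
      have : leftQuot w (atomInt (stateLang M) {p, r}) = auxLg M {f p, f r} Y := by
        ext x
        rw [key]
        simp only [auxLg, Set.mem_ofPred_eq, Finset.mem_insert, Finset.mem_singleton]
        constructor
        · intro h
          refine ⟨?_, ?_⟩
          · rintro y (rfl | rfl)
            · exact (h p).1 (Or.inl rfl)
            · exact (h r).1 (Or.inr rfl)
          · intro y hy
            obtain ⟨-, j, hj, rfl⟩ := (hmY y).1 hy
            exact (h j).2 hj
        · rintro ⟨h1, h2⟩ i
          refine ⟨?_, fun hi => ?_⟩
          · rintro (rfl | rfl)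
            · exact h1 _ (Or.inl rfl)
            · exact h1 _ (Or.inr rfl)
          · by_cases hil : f i = l
            · rw [hil]; exact hE x
            · exact h2 _ ((hmY _).2 ⟨hil, i, hi, rfl⟩)
      rw [this]
      apply hmemT
      · intro i hi
        simp only [Finset.mem_insert, Finset.mem_singleton] at hi
        rcases hi with rfl | rfl <;> simp [hmid, hfz, hfp, hfr]
      · exact Finset.card_pair hfpr
      · intro y hy
        obtain ⟨h1, j, hj, rfl⟩ := (hmY y).1 hy
        simp [hmid, h1, hfz]
      · rw [Finset.disjoint_left]
        intro y hy hy2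
        obtain ⟨h1, j, hj, rfl⟩ := (hmY y).1 hy2
        apply (hv' j).2 hj
        simp only [Finset.mem_insert, Finset.mem_singleton] at hy
        rcases hy with h | h
        · rw [h]; exact (hv' p).1 (Or.inl rfl)
        · rw [h]; exact (hv' r).1 (Or.inr rfl)
      · obtain ⟨i, hi, hfi⟩ := aux_drop hn h0 h1 M hstart hmin hempty hsf w hw
        have hip : i ≠ p := by rintro rfl; exact hfp hfi
        have hir : i ≠ r := by rintro rfl; exact hfr hfi
        have hYs : Y ⊆ (((Finset.univ \ {p, r}).erase l).erase i).image f := by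
          intro y hy
          obtain ⟨h1, j, hj, rfl⟩ := (hmY y).1 hy
          refine Finset.mem_image_of_mem f ?_
          simp only [Finset.mem_erase, Finset.mem_sdiff, Finset.mem_univ, Finset.mem_insert,
            Finset.mem_singleton]
          refine ⟨?_, ?_, trivial, hj⟩
          · rintro rfl; exact h1 hfi
          · rintro rfl; exact h1 hfl
        refine (Finset.card_le_card hYs).trans (Finset.card_image_le.trans ?_)
        rw [Finset.card_erase_of_mem, Finset.card_erase_of_mem,
          Finset.card_sdiff_of_subset (Finset.subset_univ _), Finset.card_pair hpr,
          Finset.card_univ, Fintype.card_fin]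
        · omega
        · simp [hpl.symm, hrl.symm]
        · simp only [Finset.mem_erase, Finset.mem_sdiff, Finset.mem_univ, Finset.mem_insert,
            Finset.mem_singleton]
          exact ⟨hi, trivial, by tauto⟩
  have hle := Set.ncard_le_ncard hsub T.finite_toSet
  rw [Set.ncard_coe_finset] at hle
  rw [quotComp] at hq
  rw [hq, Finset.sum_Icc_succ_top (by norm_num : (1 : ℕ) ≤ 1 + 1), Finset.Icc_self,
    Finset.sum_singleton] at hle
  have hpos : 0 < ∑ y ∈ Finset.Icc 0 (n - 2 - 2),
      Nat.choose (n - 2) 1 * Nat.choose (n - 2 - 1) y := by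
    apply Finset.sum_pos
    · intro y hy
      rw [Finset.mem_Icc] at hy
      exact Nat.mul_pos (Nat.choose_pos (by omega)) (Nat.choose_pos (by omega))
    · exact ⟨0, by simp⟩
  simp only [Nat.reduceAdd] at hle
  omega

/-- If a suffix-free regular language with minimal DFA `M` on `Q_n` (initial state
`0`, empty state `n−1`, quotients the state languages) meets the atom-complexity
bounds, i.e. for every nonempty `S ⊆ {1,…,n−2}` the atomic intersection `A_S` is an
atom with `κ(A_S) = 1 + Σ_{x=1}^{|S|} Σ_{y=0}^{n−2−|S|} C(n−2,x)·C(n−2−x,y)`, then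
the transition semigroup of `M` is contained in `Wsf(n)` and not contained in
`Vsf(n)`. -/
theorem stmt18 {α : Type} (n : ℕ) (hn : 4 ≤ n) (M : DFA α (Fin n))
    (hstart : M.start = ⟨0, by omega⟩) (hmin : MinimalDFA M)
    (hempty : stateLang M ⟨n - 1, by omega⟩ = ∅)
    (hsf : SuffixFree (acceptsSet M))
    (hatoms : ∀ S : Set (Fin n), S ≠ ∅ → (∀ i ∈ S, 0 < i.val ∧ i.val < n - 1) →
      atomInt (stateLang M) S ≠ ∅ ∧
      quotComp (atomInt (stateLang M) S) =
        1 + ∑ x ∈ Finset.Icc 1 S.ncard, ∑ y ∈ Finset.Icc 0 (n - 2 - S.ncard),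
          Nat.choose (n - 2) x * Nat.choose (n - 2 - x) y) :
    transSemigroup M ⊆ Wsf n (by omega) ∧ ¬ transSemigroup M ⊆ Vsf n (by omega) := by
  have hB := aux_bsf hn (by omega) (by omega) M hstart hmin hempty hsf
  refine ⟨?_, ?_⟩
  · intro t ht
    refine ⟨hB ht, ?_⟩
    obtain ⟨w, hw, rfl⟩ := ht
    by_contra! hc
    obtain ⟨h0, q, hq1, hq2, hq3⟩ := hc
    have hz := aux_zero hn (by omega) (by omega) M hstart hmin hempty hsf w hw
    have hmidd : ∀ i : Fin n, M.evalFrom i w ≠ ⟨n - 1, by omega⟩ →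
        0 < (M.evalFrom i w).val ∧ (M.evalFrom i w).val < n - 1 := by
      intro i hi
      have h1 := hz i
      rw [Ne, Fin.ext_iff] at h1 hi
      simp only at h1 hi
      have := (M.evalFrom i w).isLt
      omega
    obtain ⟨x, hx, hx1, hx2⟩ := aux_merge n hn (by omega) (by omega) M hstart hmin hempty hsf hatoms _ _
      (fun h => h0 (aux_sf' hn (by omega) (by omega) M hstart hmin hempty hsf q hq1 w h)) (hmidd _ h0) (hmidd _ hq3)
    apply hx2
    rw [← DFA.evalFrom_of_append] at hx1 ⊢
    rw [← DFA.evalFrom_of_append] at hx1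
    exact aux_sf' hn (by omega) (by omega) M hstart hmin hempty hsf q hq1 _ hx1
  · intro hV
    obtain ⟨x, hx, hx1, hx2⟩ := aux_merge n hn (by omega) (by omega) M hstart hmin hempty hsf hatoms
      ⟨1, by omega⟩ ⟨2, by omega⟩ (by simp) ⟨by simp, by simp; omega⟩ ⟨by simp, by simp; omega⟩
    rcases (hV ⟨x, hx, rfl⟩).2 ⟨1, by omega⟩ ⟨2, by omega⟩ (by simp) with h | h
    · exact hx2 h.1
    · exact h hx1
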